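/- Let W be a subspace of V. If a subset S' ⊆ ℕ satisfies (i) W ∩ span{e_n : n ∈ S'} = {0} and (ii) for every m ∈ ℕ, e_m ∈ W + span{e_n : n ∈ S', n ≤ m}, then S' = S(W). In particular, C(W) is the unique complement of W spanned by a subset of the basis vectors having property (ii). -/

import Mathlib

/-- The index set `S(W)` of the formal-basis-style complement, defined by strong
recursion: `n ∈ S(W)` iff `e n ∉ W + span {e k : k ∈ S(W), k < n}`. -/
noncomputable def formalBasisIndexSet {𝔽 V : Type*} [Field 𝔽] [AddCommGroup V] [Module 𝔽 V]
    (e : ℕ → V) (W : Submodule 𝔽 V) (n : ℕ) : Prop :=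
  Nat.strongRecOn (motive := fun _ => Prop) n (fun n ih =>
    e n ∉ W ⊔ Submodule.span 𝔽 {v | ∃ k, ∃ h : k < n, ih k h ∧ v = e k})

/-- The formal-basis-style complement `C(W) = span {e n : n ∈ S(W)}`. -/
noncomputable def formalBasisComplement {𝔽 V : Type*} [Field 𝔽] [AddCommGroup V] [Module 𝔽 V]
    (e : ℕ → V) (W : Submodule 𝔽 V) : Submodule 𝔽 V :=
  Submodule.span 𝔽 (e '' {n | formalBasisIndexSet e W n})

/-- The recursive characterization of `S(W)`. -/
theorem formalBasisIndexSet_iff {𝔽 V : Type*} [Field 𝔽] [AddCommGroup V] [Module 𝔽 V]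
    (e : ℕ → V) (W : Submodule 𝔽 V) (n : ℕ) :
    formalBasisIndexSet e W n ↔
      e n ∉ W ⊔ Submodule.span 𝔽 (e '' {k | formalBasisIndexSet e W k ∧ k < n}) := by
  have hset : e '' {k | formalBasisIndexSet e W k ∧ k < n} =
      {v | ∃ k, ∃ _ : k < n, formalBasisIndexSet e W k ∧ v = e k} := by
    ext v
    constructor
    · rintro ⟨k, ⟨hk, hlt⟩, rfl⟩
      exact ⟨k, hlt, hk, rfl⟩
    · rintro ⟨k, hlt, hk, rfl⟩
      exact ⟨k, ⟨hk, hlt⟩, rfl⟩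
  rw [hset]
  conv_lhs => unfold formalBasisIndexSet
  rw [Nat.strongRecOn_eq]
  rfl

/-- If `b` is linearly independent and `W` meets the span of `b '' S` trivially, then for `n ∈ S`
the vector `b n` is not in the sum of `W` and the span of `b '' T`, for any `T ⊆ S` not containing
`n`. -/
theorem LinearIndependent.notMem_sup_span_image {ι 𝔽 V : Type*} [Field 𝔽] [AddCommGroup V]
    [Module 𝔽 V] {b : ι → V} (hb : LinearIndependent 𝔽 b) {W : Submodule 𝔽 V} {S T : Set ι}
    (hW : W ⊓ Submodule.span 𝔽 (b '' S) = ⊥) (hT : T ⊆ S) {n : ι} (hn : n ∈ S) (hnT : n ∉ T) :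
    b n ∉ W ⊔ Submodule.span 𝔽 (b '' T) := by
  intro hmem
  obtain ⟨w, hw, u, hu, hwu⟩ := Submodule.mem_sup.mp hmem
  have huS : u ∈ Submodule.span 𝔽 (b '' S) := Submodule.span_mono (Set.image_mono hT) hu
  have hwS : w ∈ Submodule.span 𝔽 (b '' S) := by
    rw [eq_sub_of_add_eq hwu]
    exact sub_mem (Submodule.subset_span (Set.mem_image_of_mem b hn)) huS
  have hw0 : w = 0 := (Submodule.mem_bot 𝔽).mp (hW ▸ Submodule.mem_inf.mpr ⟨hw, hwS⟩)
  rw [hw0, zero_add] at hwu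
  exact hb.notMem_span_image hnT (hwu ▸ hu)

/-- Uniqueness of the formal-basis-style complement: any index set `S'` whose span is a
complement of `W` with the triangularity property (ii) equals `S(W)`. -/
theorem formalBasisIndexSet_unique {𝔽 V : Type*} [Field 𝔽] [AddCommGroup V] [Module 𝔽 V]
    (b : Module.Basis ℕ 𝔽 V) (W : Submodule 𝔽 V) (S' : Set ℕ)
    (h1 : W ⊓ Submodule.span 𝔽 (⇑b '' S') = ⊥)
    (h2 : ∀ m : ℕ, b m ∈ W ⊔ Submodule.span 𝔽 (⇑b '' {n ∈ S' | n ≤ m})) :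
    S' = {n | formalBasisIndexSet ⇑b W n} := by
  ext n
  induction n using Nat.strong_induction_on with
  | _ n ih =>
    have hset : {k | formalBasisIndexSet (⇑b) W k ∧ k < n} = {k ∈ S' | k < n} := by
      ext k
      exact and_congr_left fun hk => (ih k hk).symm
    rw [Set.mem_ofPred_eq, formalBasisIndexSet_iff, hset]
    constructor
    · intro hn
      exact b.linearIndependent.notMem_sup_span_image h1 (Set.sep_subset _ _) hn
        fun h => lt_irrefl n h.2
    · intro hn
      by_contra hnS
      have hle : {k ∈ S' | k ≤ n} = {k ∈ S' | k < n} := by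
        ext k
        exact and_congr_right fun hk =>
          ⟨fun h => lt_of_le_of_ne h fun hkn => hnS (hkn ▸ hk), le_of_lt⟩
      exact hn (hle ▸ h2 n)
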